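/- Fix a finite POMDP with nonnegative rewards (r x a ≥ 0 for all x, a). Fix k ≥ 1, a belief b₀ and actions a₀, …, a_{k−1}. Let φ₀ = b₀, φ_{j+1} = φ_j · a_j and X^R_j = {x : φ_j x > 0}, and assume (O x) z > 0 for every j ∈ {1, …, k}, every x ∈ X^R_j and every z ∈ Z. Define C_k = ∏_{j=1}^k (min {(O x) z : z ∈ Z, x ∈ X^R_j}) / (max {(O x) z : z ∈ Z, x ∈ X^R_j}). Then for every observation sequence z₁, …, z_k ∈ Z, the posterior beliefs b_j = (b_{j−1})^{a_{j−1}, z_j} are well-defined, and for every horizon L ≥ 1 and every action a_k: Q L b_k a_k ≤ (1 / C_k) * Q^{FO} L φ_k a_k. (Upper-bound part of Theorem 4 for a fully observable topology on the first k steps.) -/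

import Mathlib

open Finset

set_option maxHeartbeats 1000000

attribute [local instance] Classical.propDecidable

/-- A finite POMDP: transition kernel, observation kernel and reward. -/
structure POMDP (X A Z : Type) where
  T : X → A → PMF X
  O : X → PMF Z
  r : X → A → ℝ

namespace POMDP

variable {X A Z : Type} [Fintype X] [Fintype A] [Fintype Z]
variable [Nonempty X] [Nonempty A] [Nonempty Z]

/-- Real-valued transition probability. -/
noncomputable def Tr (M : POMDP X A Z) (x : X) (a : A) (x' : X) : ℝ :=
  ((M.T x a) x').toReal

/-- Real-valued observation probability. -/
noncomputable def Ob (M : POMDP X A Z) (x : X) (z : Z) : ℝ :=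
  ((M.O x) z).toReal

/-- A belief: nonnegative and sums to one. -/
def IsBelief (b : X → ℝ) : Prop :=
  (∀ x, 0 ≤ b x) ∧ ∑ x, b x = 1

/-- The propagated belief `b·a`. -/
noncomputable def prop (M : POMDP X A Z) (b : X → ℝ) (a : A) : X → ℝ :=
  fun x' => ∑ x, b x * M.Tr x a x'

/-- Expected reward `R(b,a)`. -/
noncomputable def Rew (M : POMDP X A Z) (b : X → ℝ) (a : A) : ℝ :=
  ∑ x, b x * M.r x a

/-- Observation likelihood `P(z ∣ b, a)`. -/
noncomputable def obsLik (M : POMDP X A Z) (z : Z) (b : X → ℝ) (a : A) : ℝ :=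
  ∑ x', M.prop b a x' * M.Ob x' z

/-- Bayes posterior `b^{a,z}`. -/
noncomputable def post (M : POMDP X A Z) (b : X → ℝ) (a : A) (z : Z) : X → ℝ :=
  fun x' => M.Ob x' z * M.prop b a x' / M.obsLik z b a

/-- Closed-loop optimal value `V`. -/
noncomputable def V (M : POMDP X A Z) : ℕ → (X → ℝ) → ℝ
  | 0, _ => 0
  | n + 1, b =>
    Finset.univ.sup' Finset.univ_nonempty fun a =>
      M.Rew b a +
        ∑ z ∈ Finset.univ.filter (fun z => 0 < M.obsLik z b a),
          M.obsLik z b a * V M n (M.post b a z)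

/-- Closed-loop optimal Q-function `Q`. -/
noncomputable def Q (M : POMDP X A Z) : ℕ → (X → ℝ) → A → ℝ
  | 0, _, _ => 0
  | n + 1, b, a =>
    M.Rew b a +
      ∑ z ∈ Finset.univ.filter (fun z => 0 < M.obsLik z b a),
        M.obsLik z b a * V M n (M.post b a z)

/-- Open-loop optimal value `W`. -/
noncomputable def W (M : POMDP X A Z) : ℕ → (X → ℝ) → ℝ
  | 0, _ => 0
  | n + 1, b =>
    Finset.univ.sup' Finset.univ_nonempty fun a =>
      M.Rew b a + W M n (M.prop b a)

/-- Open-loop Q-function `Q^{OL}`. -/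
noncomputable def QOL (M : POMDP X A Z) : ℕ → (X → ℝ) → A → ℝ
  | 0, _, _ => 0
  | n + 1, b, a => M.Rew b a + W M n (M.prop b a)

/-- Fully observable (MDP) optimal value `U`. -/
noncomputable def U (M : POMDP X A Z) : ℕ → X → ℝ
  | 0, _ => 0
  | n + 1, x =>
    Finset.univ.sup' Finset.univ_nonempty fun a =>
      M.r x a + ∑ x', M.Tr x a x' * U M n x'

/-- QMDP Q-function `Q^{FO}`. -/
noncomputable def QFO (M : POMDP X A Z) : ℕ → (X → ℝ) → A → ℝ
  | 0, _, _ => 0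
  | n + 1, b, a => M.Rew b a + ∑ x', M.prop b a x' * U M n x'

/-- Adaptive open-loop optimal value `V^{AOL}_β` on histories of actions and observations. -/
noncomputable def VAOL (M : POMDP X A Z) (β : List (A ⊕ Z) → Bool) :
    ℕ → (X → ℝ) → List (A ⊕ Z) → ℝ
  | 0, _, _ => 0
  | n + 1, b, h =>
    Finset.univ.sup' Finset.univ_nonempty fun a =>
      M.Rew b a +
        (if β h = true then VAOL M β n (M.prop b a) (h ++ [Sum.inl a])
        else
          ∑ z ∈ Finset.univ.filter (fun z => 0 < M.obsLik z b a),
            M.obsLik z b a * VAOL M β n (M.post b a z) (h ++ [Sum.inl a, Sum.inr z]))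

/-- Adaptive open-loop Q-function `Q^{AOL}_β`. -/
noncomputable def QAOL (M : POMDP X A Z) (β : List (A ⊕ Z) → Bool) :
    ℕ → (X → ℝ) → A → List (A ⊕ Z) → ℝ
  | 0, _, _, _ => 0
  | n + 1, b, a, h =>
    M.Rew b a +
      (if β h = true then VAOL M β n (M.prop b a) (h ++ [Sum.inl a])
      else
        ∑ z ∈ Finset.univ.filter (fun z => 0 < M.obsLik z b a),
          M.obsLik z b a * VAOL M β n (M.post b a z) (h ++ [Sum.inl a, Sum.inr z]))

/-- Point-mass belief at `x'`. -/
noncomputable def delta (x' : X) : X → ℝ := fun x => if x = x' then 1 else 0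

/-- Adaptive fully-observable optimal value `V^{AFO}_β` on histories of
actions, observations and states. -/
noncomputable def VAFO (M : POMDP X A Z) (β : List (A ⊕ (Z ⊕ X)) → Bool) :
    ℕ → (X → ℝ) → List (A ⊕ (Z ⊕ X)) → ℝ
  | 0, _, _ => 0
  | n + 1, b, h =>
    Finset.univ.sup' Finset.univ_nonempty fun a =>
      M.Rew b a +
        (if β h = true then
          ∑ x', M.prop b a x' *
            VAFO M β n (delta x') (h ++ [Sum.inl a, Sum.inr (Sum.inr x')])
        else
          ∑ z ∈ Finset.univ.filter (fun z => 0 < M.obsLik z b a),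
            M.obsLik z b a *
              VAFO M β n (M.post b a z) (h ++ [Sum.inl a, Sum.inr (Sum.inl z)]))

/-- Adaptive fully-observable Q-function `Q^{AFO}_β`. -/
noncomputable def QAFO (M : POMDP X A Z) (β : List (A ⊕ (Z ⊕ X)) → Bool) :
    ℕ → (X → ℝ) → A → List (A ⊕ (Z ⊕ X)) → ℝ
  | 0, _, _, _ => 0
  | n + 1, b, a, h =>
    M.Rew b a +
      (if β h = true then
        ∑ x', M.prop b a x' *
          VAFO M β n (delta x') (h ++ [Sum.inl a, Sum.inr (Sum.inr x')])
      else
        ∑ z ∈ Finset.univ.filter (fun z => 0 < M.obsLik z b a),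
          M.obsLik z b a *
            VAFO M β n (M.post b a z) (h ++ [Sum.inl a, Sum.inr (Sum.inl z)]))

/-- Depth-indexed adaptive open-loop value. -/
noncomputable def VAOLd (M : POMDP X A Z) (β : ℕ → Bool) : ℕ → ℕ → (X → ℝ) → ℝ
  | _, 0, _ => 0
  | d, n + 1, b =>
    Finset.univ.sup' Finset.univ_nonempty fun a =>
      M.Rew b a +
        (if β d = true then VAOLd M β (d + 1) n (M.prop b a)
        else
          ∑ z ∈ Finset.univ.filter (fun z => 0 < M.obsLik z b a),
            M.obsLik z b a * VAOLd M β (d + 1) n (M.post b a z))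

/-- Depth-indexed adaptive fully-observable value. -/
noncomputable def VAFOd (M : POMDP X A Z) (β : ℕ → Bool) : ℕ → ℕ → (X → ℝ) → ℝ
  | _, 0, _ => 0
  | d, n + 1, b =>
    Finset.univ.sup' Finset.univ_nonempty fun a =>
      M.Rew b a +
        (if β d = true then
          ∑ x', M.prop b a x' * VAFOd M β (d + 1) n (delta x')
        else
          ∑ z ∈ Finset.univ.filter (fun z => 0 < M.obsLik z b a),
            M.obsLik z b a * VAFOd M β (d + 1) n (M.post b a z))

/-- Open-loop propagated beliefs `φ₀ = b`, `φ_{i+1} = φ_i · a i` along a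
finite action sequence. -/
noncomputable def propFin (M : POMDP X A Z) (b : X → ℝ) {n : ℕ} (a : Fin n → A)
    (j : Fin (n + 1)) : X → ℝ :=
  Fin.induction b (fun i ih => M.prop ih (a i)) j

end POMDP

namespace POMDP

section helpers

set_option linter.unusedSectionVars false

variable {X A Z : Type} [Fintype X] [Fintype A] [Fintype Z]
variable [Nonempty X] [Nonempty A] [Nonempty Z]

theorem pmf_toReal_sum {Y : Type} [Fintype Y] (p : PMF Y) : ∑ y, (p y).toReal = 1 := by
  rw [← ENNReal.toReal_sum (fun y _ => p.apply_ne_top y)]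
  have h := p.tsum_coe
  rw [tsum_fintype] at h
  rw [h]; simp

theorem Tr_nonneg (M : POMDP X A Z) (x : X) (a : A) (x' : X) : 0 ≤ M.Tr x a x' :=
  ENNReal.toReal_nonneg

theorem Ob_nonneg (M : POMDP X A Z) (x : X) (z : Z) : 0 ≤ M.Ob x z :=
  ENNReal.toReal_nonneg

theorem Tr_sum (M : POMDP X A Z) (x : X) (a : A) : ∑ x', M.Tr x a x' = 1 :=
  pmf_toReal_sum _

theorem Ob_sum (M : POMDP X A Z) (x : X) : ∑ z, M.Ob x z = 1 :=
  pmf_toReal_sum _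

theorem prop_nonneg (M : POMDP X A Z) {b : X → ℝ} (hb : ∀ x, 0 ≤ b x) (a : A) (x : X) :
    0 ≤ M.prop b a x :=
  Finset.sum_nonneg fun y _ => mul_nonneg (hb y) (M.Tr_nonneg y a x)

theorem prop_mul_sum (M : POMDP X A Z) (b : X → ℝ) (a : A) (u : X → ℝ) :
    ∑ x', M.prop b a x' * u x' = ∑ x, b x * ∑ x', M.Tr x a x' * u x' := by
  simp only [prop, Finset.sum_mul, Finset.mul_sum]
  rw [Finset.sum_comm]
  simp only [mul_assoc]

theorem prop_sum (M : POMDP X A Z) (b : X → ℝ) (a : A) :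
    ∑ x', M.prop b a x' = ∑ x, b x := by
  have h := M.prop_mul_sum b a (fun _ => 1)
  simpa [Tr_sum] using h

theorem U_nonneg (M : POMDP X A Z) (hr : ∀ (x : X) (a : A), 0 ≤ M.r x a) (n : ℕ) (x : X) :
    0 ≤ M.U n x := by
  induction n generalizing x with
  | zero => simp [U]
  | succ n ih =>
    rw [U]
    obtain ⟨a⟩ := ‹Nonempty A›
    refine le_trans ?_ (Finset.le_sup' _ (Finset.mem_univ a))
    exact add_nonneg (hr x a) (Finset.sum_nonneg fun y _ => mul_nonneg (M.Tr_nonneg _ _ _) (ih y))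

theorem step_le (M : POMDP X A Z) (hr : ∀ (x : X) (a : A), 0 ≤ M.r x a) (n : ℕ)
    (ih : ∀ b : X → ℝ, (∀ x, 0 ≤ b x) → M.V n b ≤ ∑ x, b x * M.U n x)
    (b : X → ℝ) (hb : ∀ x, 0 ≤ b x) (a : A) :
    ∑ z ∈ Finset.univ.filter (fun z => 0 < M.obsLik z b a),
        M.obsLik z b a * V M n (M.post b a z) ≤ ∑ x', M.prop b a x' * M.U n x' := by
  have hp := M.prop_nonneg hb a
  calc _ ≤ ∑ z ∈ Finset.univ.filter (fun z => 0 < M.obsLik z b a),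
        ∑ x, M.Ob x z * M.prop b a x * M.U n x := by
        refine Finset.sum_le_sum fun z hz => ?_
        have hz' : 0 < M.obsLik z b a := (Finset.mem_filter.1 hz).2
        have h1 := ih (M.post b a z) (fun x =>
          div_nonneg (mul_nonneg (M.Ob_nonneg x z) (hp x)) hz'.le)
        refine (mul_le_mul_of_nonneg_left h1 hz'.le).trans (le_of_eq ?_)
        rw [Finset.mul_sum]
        refine Finset.sum_congr rfl fun x _ => ?_
        rw [post]
        field_simp
    _ ≤ ∑ z, ∑ x, M.Ob x z * M.prop b a x * M.U n x :=
        Finset.sum_le_sum_of_subset_of_nonneg (Finset.filter_subset _ _) fun z _ _ =>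
          Finset.sum_nonneg fun x _ =>
            mul_nonneg (mul_nonneg (M.Ob_nonneg x z) (hp x)) (M.U_nonneg hr n x)
    _ = _ := by
        rw [Finset.sum_comm]
        refine Finset.sum_congr rfl fun x _ => ?_
        simp only [mul_assoc]
        rw [← Finset.sum_mul, Ob_sum, one_mul]

theorem V_le (M : POMDP X A Z) (hr : ∀ (x : X) (a : A), 0 ≤ M.r x a) (n : ℕ) :
    ∀ b : X → ℝ, (∀ x, 0 ≤ b x) → M.V n b ≤ ∑ x, b x * M.U n x := by
  induction n with
  | zero => intro b _; simp [U, V]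
  | succ n ih =>
    intro b hb
    rw [V]
    refine Finset.sup'_le _ _ fun a _ => ?_
    refine (add_le_add_right (M.step_le hr n ih b hb a) _).trans ?_
    rw [prop_mul_sum, Rew, ← Finset.sum_add_distrib]
    refine Finset.sum_le_sum fun x _ => ?_
    rw [← mul_add]
    refine mul_le_mul_of_nonneg_left ?_ (hb x)
    rw [U]
    exact Finset.le_sup' (fun a => M.r x a + ∑ x', M.Tr x a x' * U M n x') (Finset.mem_univ a)

theorem Q_le_QFO (M : POMDP X A Z) (hr : ∀ (x : X) (a : A), 0 ≤ M.r x a) (L : ℕ)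
    (b : X → ℝ) (hb : ∀ x, 0 ≤ b x) (a : A) : M.Q L b a ≤ M.QFO L b a := by
  cases L with
  | zero => simp [Q, QFO]
  | succ n => exact add_le_add_right (M.step_le hr n (M.V_le hr n) b hb a) _

theorem QFO_le (M : POMDP X A Z) (hr : ∀ (x : X) (a : A), 0 ≤ M.r x a) (L : ℕ)
    (b φ : X → ℝ) (K : ℝ) (h : ∀ x, b x ≤ K * φ x) (a : A) :
    M.QFO L b a ≤ K * M.QFO L φ a := by
  cases L with
  | zero => simp [QFO]
  | succ n =>
    simp only [QFO, prop_mul_sum, Rew, ← Finset.sum_add_distrib, ← mul_add]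
    rw [Finset.mul_sum]
    refine Finset.sum_le_sum fun x _ => ?_
    rw [← mul_assoc]
    refine mul_le_mul_of_nonneg_right (h x) (add_nonneg (hr x a) ?_)
    exact Finset.sum_nonneg fun y _ => mul_nonneg (M.Tr_nonneg _ _ _) (M.U_nonneg hr n y)

/-- One Bayes update against one open-loop propagation. -/
theorem post_step (M : POMDP X A Z) (b φ : X → ℝ) (K : ℝ) (a : A) (z : Z)
    (hb : IsBelief b) (hφ : ∀ x, 0 ≤ φ x) (hK : 0 < K) (h : ∀ x, b x ≤ K * φ x)
    (ψ : X → ℝ) (hψ : ψ = M.prop φ a)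
    (hobs : ∀ x : X, 0 < ψ x → ∀ z : Z, 0 < M.Ob x z) :
    0 < M.obsLik z b a ∧ IsBelief (M.post b a z) ∧ (∀ x, 0 ≤ ψ x) ∧
      0 < sInf (Set.image2 M.Ob {x | 0 < ψ x} (Set.univ : Set Z)) /
            sSup (Set.image2 M.Ob {x | 0 < ψ x} (Set.univ : Set Z)) ∧
      ∀ x, M.post b a z x ≤
        (K / (sInf (Set.image2 M.Ob {x | 0 < ψ x} (Set.univ : Set Z)) /
            sSup (Set.image2 M.Ob {x | 0 < ψ x} (Set.univ : Set Z)))) * ψ x := by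
  set S := Set.image2 M.Ob {x | 0 < ψ x} (Set.univ : Set Z) with hS
  have hψ0 : ∀ x, 0 ≤ ψ x := fun x => by rw [hψ]; exact M.prop_nonneg hφ a x
  have hp0 := M.prop_nonneg hb.1 a
  have hps : ∑ x, M.prop b a x = 1 := by rw [prop_sum, hb.2]
  have hpk : ∀ x, M.prop b a x ≤ K * ψ x := fun x => by
    rw [hψ, prop, prop, Finset.mul_sum]
    refine Finset.sum_le_sum fun y _ => ?_
    rw [← mul_assoc]
    exact mul_le_mul_of_nonneg_right (h y) (M.Tr_nonneg _ _ _)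
  have hsupp : ∀ x, 0 < M.prop b a x → 0 < ψ x := fun x hx =>
    pos_of_mul_pos_right (hx.trans_le (hpk x)) hK.le
  obtain ⟨x₀, -, hx₀⟩ : ∃ x ∈ Finset.univ, 0 < M.prop b a x := by
    by_contra! hc
    have := Finset.sum_nonpos hc
    linarith
  have hfin : S.Finite := Set.Finite.image2 _ (Set.toFinite _) Set.finite_univ
  have hne : S.Nonempty := ⟨M.Ob x₀ z, x₀, hsupp x₀ hx₀, z, trivial, rfl⟩
  have hinf : 0 < sInf S := by
    obtain ⟨x, hx, w, -, hw⟩ := hne.csInf_mem hfin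
    rw [← hw]; exact hobs x hx w
  have hsup : 0 < sSup S := hinf.trans_le (csInf_le_csSup hne hfin.bddBelow hfin.bddAbove)
  have hlik : sInf S ≤ M.obsLik z b a := by
    rw [obsLik]
    calc sInf S = ∑ x, M.prop b a x * sInf S := by rw [← Finset.sum_mul, hps, one_mul]
      _ ≤ _ := Finset.sum_le_sum fun x _ => by
        rcases (hp0 x).eq_or_lt with h0 | h0
        · simp [← h0]
        · exact mul_le_mul_of_nonneg_left
            (csInf_le hfin.bddBelow ⟨x, hsupp x h0, z, trivial, rfl⟩) h0.le
  have hlik0 := hinf.trans_le hlik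
  refine ⟨hlik0, ⟨fun x => div_nonneg (mul_nonneg (M.Ob_nonneg x z) (hp0 x)) hlik0.le, ?_⟩,
    hψ0, div_pos hinf hsup, fun x => ?_⟩
  · simp only [post]
    rw [← Finset.sum_div, div_eq_one_iff_eq hlik0.ne', obsLik]
    exact Finset.sum_congr rfl fun x _ => mul_comm _ _
  · have h1 : M.Ob x z * M.prop b a x ≤ sSup S * (K * ψ x) := by
      rcases (hp0 x).eq_or_lt with h0 | h0
      · rw [← h0, mul_zero]
        exact mul_nonneg hsup.le (mul_nonneg hK.le (hψ0 x))
      · exact mul_le_mul (le_csSup hfin.bddAbove ⟨x, hsupp x h0, z, trivial, rfl⟩) (hpk x)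
          h0.le hsup.le
    calc M.post b a z x ≤ sSup S * (K * ψ x) / sInf S :=
          div_le_div₀ (mul_nonneg hsup.le (mul_nonneg hK.le (hψ0 x))) h1 hinf hlik
      _ = _ := by field_simp

theorem post_iter (M : POMDP X A Z) (b₀ : X → ℝ) (hb₀ : IsBelief b₀) (k : ℕ) :
    ∀ (a : Fin k → A) (φ : Fin (k + 1) → X → ℝ), φ 0 = b₀ →
    (∀ j : Fin k, φ j.succ = M.prop (φ j.castSucc) (a j)) →
    (∀ j : Fin k, ∀ x : X, 0 < φ j.succ x → ∀ z : Z, 0 < M.Ob x z) →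
    ∀ (z : Fin k → Z) (bp : Fin (k + 1) → X → ℝ), bp 0 = b₀ →
      (∀ j : Fin k, bp j.succ = M.post (bp j.castSucc) (a j) (z j)) →
      (∀ j : Fin k, 0 < M.obsLik (z j) (bp j.castSucc) (a j)) ∧
      IsBelief (bp (Fin.last k)) ∧ (∀ x, 0 ≤ φ (Fin.last k) x) ∧
      0 < (∏ j : Fin k,
            sInf (Set.image2 M.Ob {x | 0 < φ j.succ x} (Set.univ : Set Z)) /
              sSup (Set.image2 M.Ob {x | 0 < φ j.succ x} (Set.univ : Set Z))) ∧
      ∀ x, bp (Fin.last k) x ≤ (1 / ∏ j : Fin k,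
            sInf (Set.image2 M.Ob {x | 0 < φ j.succ x} (Set.univ : Set Z)) /
              sSup (Set.image2 M.Ob {x | 0 < φ j.succ x} (Set.univ : Set Z))) *
            φ (Fin.last k) x := by
  induction k with
  | zero =>
    intro a φ h0 _ _ z bp hb0 _
    have e : Fin.last 0 = 0 := rfl
    rw [e, h0, hb0]
    refine ⟨fun j => j.elim0, hb₀, hb₀.1, by simp, by simp⟩
  | succ k ih =>
    intro a φ h0 hs hobs z bp hb0 hbs
    obtain ⟨i1, i2, i3, i4, i5⟩ := ih (fun j => a j.castSucc) (fun j => φ j.castSucc) h0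
      (fun j => hs j.castSucc) (fun j => hobs j.castSucc) (fun j => z j.castSucc)
      (fun j => bp j.castSucc) hb0 (fun j => hbs j.castSucc)
    obtain ⟨s1, s2, s3, s4, s5⟩ := M.post_step _ _ _ (a (Fin.last k)) (z (Fin.last k)) i2 i3
      (one_div_pos.2 i4) i5 _ (hs (Fin.last k)) (hobs (Fin.last k))
    rw [Fin.prod_univ_castSucc]
    refine ⟨fun j => ?_, ?_, s3, mul_pos i4 s4, fun x => ?_⟩
    · refine Fin.lastCases s1 (fun j => i1 j) j
    · rw [← Fin.succ_last, hbs]; exact s2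
    · have h := s5 x
      rw [← hbs, div_div] at h
      exact h

end helpers

end POMDP

/-- upper-bound part of Theorem 4, fully observable topology
on the first `k` steps: under positivity of the observation model on the
reachable sets, for every observation sequence the posterior beliefs are
well-defined and the closed-loop optimal Q-value at the final posterior belief
is upper-bounded by `(1 / C_k)` times the QMDP Q-value at the open-loop
propagated belief. -/
theorem skip_replanning_upper_bound {X A Z : Type}
    [Fintype X] [Fintype A] [Fintype Z]
    [Nonempty X] [Nonempty A] [Nonempty Z]
    (M : POMDP X A Z) (hr : ∀ (x : X) (a : A), 0 ≤ M.r x a)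
    (k : ℕ) (hk : 1 ≤ k)
    (b₀ : X → ℝ) (hb₀ : POMDP.IsBelief b₀)
    (a : Fin k → A)
    (φ : Fin (k + 1) → X → ℝ)
    (hφ0 : φ 0 = b₀)
    (hφ : ∀ j : Fin k, φ j.succ = M.prop (φ j.castSucc) (a j))
    (hobs : ∀ j : Fin k, ∀ x : X, 0 < φ j.succ x → ∀ z : Z, 0 < M.Ob x z) :
    ∀ (z : Fin k → Z) (bp : Fin (k + 1) → X → ℝ),
      bp 0 = b₀ →
      (∀ j : Fin k, bp j.succ = M.post (bp j.castSucc) (a j) (z j)) →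
      (∀ j : Fin k, 0 < M.obsLik (z j) (bp j.castSucc) (a j)) ∧
        ∀ L : ℕ, 1 ≤ L → ∀ aₖ : A,
          M.Q L (bp (Fin.last k)) aₖ ≤
            (1 /
                ∏ j : Fin k,
                  sInf (Set.image2 M.Ob {x | 0 < φ j.succ x} (Set.univ : Set Z)) /
                    sSup (Set.image2 M.Ob {x | 0 < φ j.succ x} (Set.univ : Set Z))) *
              M.QFO L (φ (Fin.last k)) aₖ := by
  intro z bp hb0 hbs
  obtain ⟨h1, h2, h3, h4, h5⟩ := M.post_iter b₀ hb₀ k a φ hφ0 hφ hobs z bp hb0 hbs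
  exact ⟨h1, fun L _ aₖ => (M.Q_le_QFO hr L _ h2.1 aₖ).trans (M.QFO_le hr L _ _ _ h5 aₖ)⟩
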